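/- arXiv:1402.3199 — 7 statements merged into one kernel-verified Lean document; each statement's English description precedes it below -/
import Mathlib

section
/- Let K ⊆ Σ* be a trace-closed language and let K_I be its I-suffix extension. Then the ω-language ext(K_I) is trace-closed. -/
open Relation

variable {A : Type*} {σ : Type*} {S : Type*}

/-- The length-`n` prefix of an ω-word. -/
def wpre (α : ℕ → A) (n : ℕ) : List A := (List.range n).map α

/-- One swap of two adjacent independent letters. -/
def SwapStep (I : A → A → Prop) (u v : List A) : Prop :=
  ∃ (x y : List A) (a b : A), I a b ∧ u = x ++ a :: b :: y ∧ v = x ++ b :: a :: y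

/-- Trace equivalence `∼_I` on finite words: the equivalence closure of adjacent swaps. -/
def TrEq (I : A → A → Prop) : List A → List A → Prop := EqvGen (SwapStep I)

/-- Trace-prefix relation `u ⊑_I v`. -/
def TrPre (I : A → A → Prop) (u v : List A) : Prop := ∃ w, TrEq I (u ++ w) v

/-- Trace equivalence `≈_I` of ω-words. -/
def OmEq (I : A → A → Prop) (α β : ℕ → A) : Prop :=
  (∀ n, ∃ m, TrPre I (wpre α n) (wpre β m)) ∧ (∀ n, ∃ m, TrPre I (wpre β n) (wpre α m))

/-- A language of finite words is trace-closed. -/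
def TraceClosed (I : A → A → Prop) (K : Set (List A)) : Prop :=
  ∀ u v, u ∈ K → TrEq I u v → v ∈ K

/-- An ω-language is trace-closed. -/
def OmTraceClosed (I : A → A → Prop) (L : Set (ℕ → A)) : Prop :=
  ∀ α β, α ∈ L → OmEq I α β → β ∈ L

/-- `ext(K)`: ω-words with some finite prefix in `K`. -/
def extL (K : Set (List A)) : Set (ℕ → A) := {α | ∃ n, wpre α n ∈ K}

/-- `lim(K)`: ω-words with infinitely many finite prefixes in `K`. -/
def limL (K : Set (List A)) : Set (ℕ → A) := {α | ∀ N, ∃ n ≥ N, wpre α n ∈ K}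

/-- `[L]_{≈_I}`: the ω-trace closure of an ω-language. -/
def omCl (I : A → A → Prop) (L : Set (ℕ → A)) : Set (ℕ → A) := {α | ∃ β ∈ L, OmEq I α β}

/-- The `I`-suffix extension `K_I`. -/
def suffExt (I : A → A → Prop) (K : Set (List A)) : Set (List A) :=
  K ∪ {w | ∃ (a : A) (u x : List A),
    u ++ [a] ∈ K ∧ (∀ b ∈ x, I a b) ∧ TrEq I w (u ++ [a] ++ x)}

/-- A language is regular iff it is recognized by a DFA with finitely many states. -/
def RegularLang (K : Set (List A)) : Prop :=
  ∃ (σ : Type) (_ : Fintype σ) (M : DFA A σ), ∀ w, w ∈ M.accepts ↔ w ∈ K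

/-- A DFA is `I`-diamond. -/
def IDiamond (I : A → A → Prop) (M : DFA A σ) : Prop :=
  ∀ q a b, I a b → M.step (M.step q a) b = M.step (M.step q b) a

/-- The ω-language of a DFA viewed as a deterministic Büchi automaton. -/
def BuchiLang (M : DFA A σ) : Set (ℕ → A) :=
  {α | ∀ N, ∃ n ≥ N, M.evalFrom M.start (wpre α n) ∈ M.accept}

/-- The weakness condition: mutually reachable states agree on acceptance. -/
def IsWeak (M : DFA A σ) : Prop :=
  ∀ q q', (∃ u, M.evalFrom q u = q') → (∃ v, M.evalFrom q' v = q) →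
    (q ∈ M.accept ↔ q' ∈ M.accept)

/-- States visited infinitely often by the run of a DFA on an ω-word. -/
def InfStates (M : DFA A σ) (α : ℕ → A) : Set σ :=
  {q | ∀ N, ∃ n ≥ N, M.evalFrom M.start (wpre α n) = q}

/-- The ω-language of a DFA equipped with a Muller acceptance family. -/
def MullerLang (M : DFA A σ) (F : Set (Set σ)) : Set (ℕ → A) := {α | InfStates M α ∈ F}

/-- An ω-language is ω-regular iff it is recognized by a deterministic Muller automaton. -/
def OmegaRegular (L : Set (ℕ → A)) : Prop :=
  ∃ (σ : Type) (_ : Fintype σ) (M : DFA A σ) (F : Set (Set σ)), MullerLang M F = L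

/-- Finite Boolean combinations of a family of sets. -/
inductive BoolComb {X : Type*} (G : Set (Set X)) : Set X → Prop
  | base {L} : L ∈ G → BoolComb G L
  | compl {L} : BoolComb G L → BoolComb G Lᶜ
  | union {L₁ L₂} : BoolComb G L₁ → BoolComb G L₂ → BoolComb G (L₁ ∪ L₂)
  | inter {L₁ L₂} : BoolComb G L₁ → BoolComb G L₂ → BoolComb G (L₁ ∩ L₂)

/-- `φ : Σ* → S` is a monoid homomorphism (words under concatenation). -/
def IsHom [Monoid S] (φ : List A → S) : Prop :=
  φ [] = 1 ∧ ∀ u v, φ (u ++ v) = φ u * φ v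

/-- Linked pair of a monoid. -/
def LinkedPair [Monoid S] (s e : S) : Prop := s * e = s ∧ e * e = e

/-- The factor `α[i, j)` of an ω-word. -/
def seg (α : ℕ → A) (i j : ℕ) : List A := (List.range (j - i)).map (fun k => α (i + k))

/-- `φ⁻¹(s)·(φ⁻¹(e))^ω`: ω-words admitting a factorization `u·v₁·v₂⋯` with
`φ(u) = s` and `φ(vᵢ) = e`. -/
def LPWords (φ : List A → S) (s e : S) : Set (ℕ → A) :=
  {α | ∃ n : ℕ → ℕ, StrictMono n ∧ φ (wpre α (n 0)) = s ∧
    ∀ i, φ (seg α (n i) (n (i + 1))) = e}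

/-- `φ` saturates an ω-language `L`. -/
def Saturates [Monoid S] (φ : List A → S) (L : Set (ℕ → A)) : Prop :=
  ∀ s e : S, LinkedPair s e → LPWords φ s e ∩ L = ∅ ∨ LPWords φ s e ⊆ L

/-- The `P`-cut property of a linked pair `(s, e)` with respect to `φ`. -/
def PCut [Monoid S] (φ : List A → S) (P : Set S) (s e : S) : Prop :=
  (∀ w : List A, w ≠ [] → φ w = e →
      ∃ j, 1 ≤ j ∧ j ≤ w.length ∧ s * e * φ (w.take j) ∈ P) ∨
  (∀ w : List A, w ≠ [] → φ w = e →
      ∀ j, 1 ≤ j → j ≤ w.length → s * e * φ (w.take j) ∉ P)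

/-- The run from `q` on `u` visits an accepting state (endpoints included). -/
def VisitsAcc (M : DFA A σ) (q : σ) (u : List A) : Prop :=
  ∃ p, p <+: u ∧ M.evalFrom q p ∈ M.accept

/-- `q ⇒_u q'`: the run from `q` on `u` ends in `q'` and visits an accepting state. -/
def FICycleClosed (I : A → A → Prop) (M : DFA A σ) : Prop :=
  ∀ u v q, TrEq I u v →
    ((M.evalFrom q u = q ∧ VisitsAcc M q u) ↔ (M.evalFrom q v = q ∧ VisitsAcc M q v))

theorem swapStep_symm {I : A → A → Prop} (hsym : ∀ a b, I a b → I b a) {s t : List A}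
    (h : SwapStep I s t) : SwapStep I t s := by
  obtain ⟨x, y, a, b, hab, rfl, rfl⟩ := h
  exact ⟨x, y, b, a, hsym _ _ hab, rfl, rfl⟩

theorem trEq_append {I : A → A → Prop} {s t : List A} (p q : List A)
    (h : TrEq I s t) : TrEq I (p ++ s ++ q) (p ++ t ++ q) := by
  induction h with
  | rel s t h =>
    obtain ⟨x, y, a, b, hab, rfl, rfl⟩ := h
    exact EqvGen.rel _ _ ⟨p ++ x, y ++ q, a, b, hab, by simp, by simp⟩
  | refl s => exact EqvGen.refl _
  | symm _ _ _ ih => exact EqvGen.symm _ _ ih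
  | trans _ _ _ _ _ ih1 ih2 => exact EqvGen.trans _ _ _ ih1 ih2

theorem trEq_length {I : A → A → Prop} {s t : List A}
    (h : TrEq I s t) : s.length = t.length := by
  induction h with
  | rel s t h =>
    obtain ⟨x, y, a, b, hab, rfl, rfl⟩ := h
    simp
  | refl s => rfl
  | symm _ _ _ ih => exact ih.symm
  | trans _ _ _ _ _ ih1 ih2 => exact ih1.trans ih2

theorem trEq_cons_comm {I : A → A → Prop} (b : A) (s : List A) (h : ∀ c ∈ s, I b c) :
    TrEq I (b :: s) (s ++ [b]) := by
  induction s with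
  | nil => exact EqvGen.refl _
  | cons c s ih =>
    refine EqvGen.trans _ (c :: b :: s) _
      (EqvGen.rel _ _ ⟨[], s, b, c, h c (by simp), rfl, rfl⟩) ?_
    have := trEq_append [c] [] (ih (fun d hd => h d (by simp [hd])))
    simpa [TrEq] using this

/-- `t` has an occurrence of `b` that can be moved to the end, leaving `v`. -/
def LastOcc (I : A → A → Prop) (v : List A) (b : A) (t : List A) : Prop :=
  ∃ t1 t2, t = t1 ++ b :: t2 ∧ (∀ c ∈ t2, I b c) ∧ TrEq I v (t1 ++ t2)

theorem lastOcc_step {I : A → A → Prop} (hsym : ∀ a b, I a b → I b a) {v : List A} {b : A}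
    {s t : List A} (hst : SwapStep I s t) (h : LastOcc I v b s) : LastOcc I v b t := by
  obtain ⟨x, y, c, d, hcd, rfl, rfl⟩ := hst
  obtain ⟨t1, t2, he, hi, hv⟩ := h
  rcases List.append_eq_append_iff.1 he with ⟨r, h1, h2⟩ | ⟨r, h1, h2⟩
  · subst h1
    rcases r with _ | ⟨e, _ | ⟨f, r⟩⟩
    · simp at h2
      obtain ⟨rfl, rfl⟩ := h2
      exact ⟨x ++ [d], y, by simp, fun e he => hi e (by simp [he]), by simpa using hv⟩
    · simp at h2
      obtain ⟨rfl, rfl, rfl⟩ := h2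
      refine ⟨x, c :: y, by simp, ?_, by simpa using hv⟩
      intro e he
      rcases List.mem_cons.1 he with rfl | he
      · exact hsym _ _ hcd
      · exact hi e he
    · simp at h2
      obtain ⟨rfl, rfl, rfl⟩ := h2
      refine ⟨x ++ d :: c :: r, t2, by simp, hi, EqvGen.trans _ _ _ hv ?_⟩
      exact EqvGen.rel _ _ ⟨x, r ++ t2, c, d, hcd, by simp, by simp⟩
  · subst h1
    rcases r with _ | ⟨e, r⟩
    · simp at h2
      obtain ⟨rfl, rfl⟩ := h2
      exact ⟨t1 ++ [d], y, by simp, fun e he => hi e (by simp [he]), by simpa using hv⟩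
    · simp at h2
      obtain ⟨rfl, rfl⟩ := h2
      refine ⟨t1, r ++ d :: c :: y, by simp, ?_, EqvGen.trans _ _ _ hv ?_⟩
      · intro e he
        apply hi
        simp at he ⊢
        tauto
      · exact EqvGen.rel _ _ ⟨t1 ++ r, y, c, d, hcd, by simp, by simp⟩

theorem lastOcc_iff {I : A → A → Prop} (hsym : ∀ a b, I a b → I b a) {v : List A} {b : A}
    {s t : List A} (hst : TrEq I s t) : LastOcc I v b s ↔ LastOcc I v b t := by
  induction hst with
  | rel s t h => exact ⟨lastOcc_step hsym h, lastOcc_step hsym (swapStep_symm hsym h)⟩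
  | refl s => rfl
  | symm _ _ _ ih => exact ih.symm
  | trans _ _ _ _ _ ih1 ih2 => exact ih1.trans ih2

theorem exists_pre_of_trPre {I : A → A → Prop} (hsym : ∀ a b, I a b → I b a)
    {K : Set (List A)} (hK : TraceClosed I K) {s : List A} (hs : s ∈ K) (β : ℕ → A) (m : ℕ)
    (h : TrPre I s (wpre β m)) : β ∈ extL (suffExt I K) := by
  induction m with
  | zero =>
    obtain ⟨w, hw⟩ := h
    have hl := trEq_length hw
    have : s = [] := by
      apply List.length_eq_zero_iff.1
      simp [wpre] at hl
      simp [hl]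
    subst this
    exact ⟨0, Or.inl (by simpa [wpre] using hs)⟩
  | succ m ih =>
    by_cases hm : TrPre I s (wpre β m)
    · exact ih hm
    obtain ⟨w, hw⟩ := h
    have hsucc : wpre β (m + 1) = wpre β m ++ [β m] := by simp [wpre, List.range_succ]
    have hL : LastOcc I (wpre β m) (β m) (s ++ w) :=
      (lastOcc_iff hsym hw).2 ⟨wpre β m, [], hsucc, by simp, by simpa [TrEq] using EqvGen.refl _⟩
    obtain ⟨t1, t2, he, hi, hv⟩ := hL
    have key : ∀ r, s = t1 ++ β m :: r → t2 = r ++ w → β ∈ extL (suffExt I K) := by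
      rintro r rfl rfl
      have h1 : TrEq I (t1 ++ β m :: r) (t1 ++ r ++ [β m]) := by
        simpa using trEq_append t1 [] (trEq_cons_comm (β m) r (fun c hc => hi c (by simp [hc])))
      refine ⟨m + 1, Or.inr ⟨β m, t1 ++ r, w, hK _ _ hs h1, fun c hc => hi c (by simp [hc]), ?_⟩⟩
      refine EqvGen.trans _ _ _ (EqvGen.symm _ _ hw) ?_
      simpa [TrEq] using trEq_append [] w h1
    rcases List.append_eq_append_iff.1 he with ⟨r, h1, h2⟩ | ⟨r, h1, h2⟩
    · subst h1
      exact absurd ⟨r ++ t2, by simpa [TrEq] using EqvGen.symm _ _ hv⟩ hm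
    · rcases r with _ | ⟨e, r⟩
      · simp at h1 h2
        subst h1
        exact absurd ⟨t2, EqvGen.symm _ _ hv⟩ hm
      · simp at h2
        obtain ⟨rfl, h2⟩ := h2
        exact key r h1 h2

/-- If `K` is trace-closed, then `ext(K_I)` is trace-closed. -/
theorem stmt0 [Fintype A] (I : A → A → Prop)
    (hirr : ∀ a, ¬ I a a) (hsym : ∀ a b, I a b → I b a)
    (K : Set (List A)) (hK : TraceClosed I K) :
    OmTraceClosed I (extL (suffExt I K)) := by
  rintro α β ⟨n, hn⟩ ⟨h, -⟩
  obtain ⟨m, z, hz⟩ := h n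
  rcases hn with hn | ⟨a, u, x, hu, -, hx⟩
  · exact exists_pre_of_trPre hsym hK hn β m ⟨z, hz⟩
  · refine exists_pre_of_trPre hsym hK hu β m ⟨x ++ z, ?_⟩
    refine EqvGen.trans _ _ _ ?_ hz
    simpa [TrEq] using trEq_append [] z (EqvGen.symm _ _ hx)
end

section
/- Let K ⊆ Σ* be a regular trace-closed language and let K_I be its I-suffix extension. Then ext(K_I) = [ext(K)]_{≈_I}, i.e. ext(K_I) is exactly the trace closure of ext(K) under ω-trace equivalence. -/
open Relation

variable {A : Type*} {σ : Type*} {S : Type*}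

theorem TrEq.congr' {I : A → A → Prop} (p q : List A) {u v : List A} (h : TrEq I u v) :
    TrEq I (p ++ u ++ q) (p ++ v ++ q) := by
  induction h with
  | rel u v h =>
    obtain ⟨x, y, a, b, hab, rfl, rfl⟩ := h
    exact EqvGen.rel _ _ ⟨p ++ x, y ++ q, a, b, hab, by simp, by simp⟩
  | refl => exact EqvGen.refl _
  | symm _ _ _ ih => exact EqvGen.symm _ _ ih
  | trans _ _ _ _ _ ih1 ih2 => exact EqvGen.trans _ _ _ ih1 ih2

theorem TrEq.len {I : A → A → Prop} {u v : List A} (h : TrEq I u v) : u.length = v.length := by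
  induction h with
  | rel u v h => obtain ⟨x, y, a, b, hab, rfl, rfl⟩ := h; simp
  | refl => rfl
  | symm _ _ _ ih => exact ih.symm
  | trans _ _ _ _ _ ih1 ih2 => exact ih1.trans ih2

/-- A letter commutes past a word of independent letters. -/
theorem TrEq.move {I : A → A → Prop} {b : A} (x : List A) (h : ∀ c ∈ x, I b c) :
    TrEq I (b :: x) (x ++ [b]) := by
  induction x with
  | nil => exact EqvGen.refl _
  | cons c x ih =>
    refine EqvGen.trans _ (c :: b :: x) _
      (EqvGen.rel _ _ ⟨[], x, b, c, h c (by simp), rfl, rfl⟩) ?_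
    have := TrEq.congr' [c] [] (ih fun d hd => h d (by simp [hd]))
    simpa [TrEq] using this

def HasLast (I : A → A → Prop) (b : A) (w s : List A) : Prop :=
  ∃ s1 s2, s = s1 ++ b :: s2 ∧ (∀ c ∈ s2, I b c) ∧ TrEq I (s1 ++ s2) w

theorem HasLast.step {I : A → A → Prop} (hsym : ∀ a b, I a b → I b a) {b : A} {w s t : List A}
    (h : SwapStep I s t) (hs : HasLast I b w s) : HasLast I b w t := by
  obtain ⟨x, y, c, d, hcd, rfl, rfl⟩ := h
  obtain ⟨s1, s2, he, h2, hw⟩ := hs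
  rw [List.append_eq_append_iff] at he
  rcases he with ⟨r, rfl, hr⟩ | ⟨r, rfl, hr⟩
  · match r, hr with
    | [], hr =>
      simp only [List.nil_append, List.cons.injEq] at hr
      obtain ⟨rfl, rfl⟩ := hr
      refine ⟨x ++ [d], y, by simp, fun e he => h2 e (by simp [he]), ?_⟩
      simpa using hw
    | [c'], hr =>
      simp only [List.cons_append, List.nil_append, List.cons.injEq] at hr
      obtain ⟨rfl, rfl, rfl⟩ := hr
      refine ⟨x, c :: y, by simp, ?_, by simpa using hw⟩
      intro e he
      rcases List.mem_cons.1 he with rfl | he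
      · exact hsym _ _ hcd
      · exact h2 e he
    | c' :: d' :: r, hr =>
      simp only [List.cons_append, List.cons.injEq] at hr
      obtain ⟨rfl, rfl, rfl⟩ := hr
      refine ⟨x ++ d :: c :: r, s2, by simp, h2, EqvGen.trans _ _ _ ?_ hw⟩
      exact EqvGen.rel _ _ ⟨x, r ++ s2, d, c, hsym _ _ hcd, by simp, by simp⟩
  · match r, hr with
    | [], hr =>
      simp only [List.nil_append, List.cons.injEq] at hr
      obtain ⟨rfl, rfl⟩ := hr
      refine ⟨s1 ++ [d], y, by simp, fun e he => h2 e (by simp [he]), ?_⟩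
      simpa using hw
    | b' :: r, hr =>
      simp only [List.cons_append, List.cons.injEq] at hr
      obtain ⟨rfl, rfl⟩ := hr
      refine ⟨s1, r ++ d :: c :: y, by simp, ?_, EqvGen.trans _ _ _ ?_ hw⟩
      · intro e he
        apply h2
        simp only [List.mem_append, List.mem_cons] at he ⊢
        tauto
      · exact EqvGen.rel _ _ ⟨s1 ++ r, y, d, c, hsym _ _ hcd, by simp, by simp⟩

theorem HasLast.iff {I : A → A → Prop} (hsym : ∀ a b, I a b → I b a) {b : A} {w s t : List A}
    (h : TrEq I s t) : HasLast I b w s ↔ HasLast I b w t := by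
  induction h with
  | rel u v h =>
    refine ⟨HasLast.step hsym h, HasLast.step hsym ?_⟩
    obtain ⟨x, y, a, b, hab, rfl, rfl⟩ := h
    exact ⟨x, y, b, a, hsym _ _ hab, rfl, rfl⟩
  | refl => rfl
  | symm _ _ _ ih => exact ih.symm
  | trans _ _ _ _ _ ih1 ih2 => exact ih1.trans ih2

theorem wpre_add (α : ℕ → A) (n k : ℕ) :
    wpre α (n + k) = wpre α n ++ (List.range k).map (fun i => α (n + i)) := by
  simp [wpre, List.range_add, Function.comp_def]

theorem wpre_tail {I : A → A → Prop} {α β : ℕ → A} {n : ℕ} (h : TrEq I (wpre α n) (wpre β n))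
    (ht : ∀ i, α (n + i) = β (n + i)) (k : ℕ) : ∃ m, TrPre I (wpre α k) (wpre β m) := by
  refine ⟨n + k, (List.range n).map (fun i => α (k + i)), ?_⟩
  rw [← wpre_add, add_comm k n, wpre_add, wpre_add]
  simp only [ht]
  exact TrEq.congr' [] _ h

/-- For regular trace-closed `K`, `ext(K_I)` equals the ω-trace
closure of `ext(K)`. -/
theorem stmt1 [Fintype A] (I : A → A → Prop)
    (hirr : ∀ a, ¬ I a a) (hsym : ∀ a b, I a b → I b a)
    (K : Set (List A)) (hreg : RegularLang K) (hK : TraceClosed I K) :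
    extL (suffExt I K) = omCl I (extL K) := by
  ext α
  constructor
  · rintro ⟨n, hn | ⟨a, u, x, hu, hx, hw⟩⟩
    · exact ⟨α, ⟨n, hn⟩, fun n => ⟨n, [], by simpa [TrEq] using EqvGen.refl _⟩,
        fun n => ⟨n, [], by simpa [TrEq] using EqvGen.refl _⟩⟩
    · set L := u ++ [a] ++ x with hL
      have hlen : L.length = n := by
        rw [← hw.len]; simp [wpre]
      let β : ℕ → A := fun i => if h : i < L.length then L[i] else α i
      have hβ : wpre β n = L := by
        apply List.ext_getElem
        · simp [wpre, hlen]
        · intro i h1 h2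
          simp [wpre, β, h2]
      have ht : ∀ i, α (n + i) = β (n + i) := by
        intro i
        simp [β, hlen]
      refine ⟨β, ⟨(u ++ [a]).length, ?_⟩, ?_, ?_⟩
      · have hle : (u ++ [a]).length + x.length = n := by rw [← hlen, hL]; simp; omega
        have h := hβ
        rw [← hle, wpre_add, hL] at h
        have := (List.append_inj h (by simp [wpre])).1
        rw [this]; exact hu
      · exact wpre_tail (n := n) (by rw [hβ]; exact hw) ht
      · exact wpre_tail (n := n) (by rw [hβ]; exact EqvGen.symm _ _ hw) (fun i => (ht i).symm)
  · rintro ⟨β, ⟨n, hn⟩, -, h⟩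
    classical
    have hm := Nat.find_spec (h n)
    have hmin := fun k => Nat.find_min (h n) (m := k)
    generalize Nat.find (h n) = m at hm hmin
    generalize wpre β n = v at *
    obtain ⟨z, hz⟩ := hm
    cases m with
    | zero =>
      have h0 := hz.len
      simp [wpre] at h0
      refine ⟨0, Or.inl ?_⟩
      rw [h0.1] at hn
      simpa [wpre] using hn
    | succ k =>
      have hs : wpre α (k + 1) = wpre α k ++ [α k] := by simp [wpre, List.range_succ]
      have hl : HasLast I (α k) (wpre α k) (v ++ z) := by
        rw [HasLast.iff hsym hz, hs]
        exact ⟨wpre α k, [], rfl, by simp, by simpa [TrEq] using EqvGen.refl _⟩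
      obtain ⟨s1, s2, he, h2, hw⟩ := hl
      have bad : ∀ r, s1 = v ++ r → False := by
        rintro r rfl
        exact hmin k (Nat.lt_succ_self k) ⟨r ++ s2, by simpa using hw⟩
      rw [List.append_eq_append_iff] at he
      rcases he with ⟨r, hr, -⟩ | ⟨r, rfl, hr⟩
      · exact (bad r hr).elim
      · cases r with
        | nil => exact (bad [] (by simp)).elim
        | cons b' r =>
          simp only [List.cons_append, List.cons.injEq] at hr
          obtain ⟨rfl, rfl⟩ := hr
          have hv : TrEq I (s1 ++ α k :: r) (s1 ++ r ++ [α k]) := by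
            have := TrEq.congr' s1 [] (TrEq.move r fun c hc => h2 c (by simp [hc]))
            simpa using this
          refine ⟨k + 1, Or.inr ⟨α k, s1 ++ r, z, hK _ _ hn hv,
            fun c hc => h2 c (by simp [hc]), ?_⟩⟩
          exact EqvGen.trans _ _ _ (EqvGen.symm _ _ hz) (TrEq.congr' [] z hv)
end

section
/- Let K ⊆ Σ* be a trace-closed language. Then ext(K) ⊆ ext(K_I) and ext(K_I) = ext((K_I)_I), i.e. iterating the I-suffix extension does not change the infinitary extension. -/
open Relation

variable {A : Type*} {σ : Type*} {S : Type*}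

theorem aux_swap_symm {I : A → A → Prop} (hsym : ∀ a b, I a b → I b a) {u v : List A}
    (h : SwapStep I u v) : SwapStep I v u := by
  obtain ⟨x, y, a, b, hi, h1, h2⟩ := h
  exact ⟨x, y, b, a, hsym _ _ hi, h2, h1⟩

theorem aux_trEq_append {I : A → A → Prop} {u v : List A} (h : TrEq I u v) (z : List A) :
    TrEq I (u ++ z) (v ++ z) := by
  unfold TrEq at *
  induction h with
  | rel u v h =>
    obtain ⟨x, y, a, b, hi, h1, h2⟩ := h
    exact EqvGen.rel _ _ ⟨x, y ++ z, a, b, hi, by simp [h1], by simp [h2]⟩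
  | refl u => exact EqvGen.refl _
  | symm u v _ ih => exact EqvGen.symm _ _ ih
  | trans u v w _ _ ih1 ih2 => exact EqvGen.trans _ _ _ ih1 ih2

/-- `c` can be moved to the end of `s`, leaving `p`. -/
def AuxQ (I : A → A → Prop) (p : List A) (c : A) (s : List A) : Prop :=
  ∃ s1 s2, s = s1 ++ c :: s2 ∧ (∀ b ∈ s2, I c b) ∧ TrEq I p (s1 ++ s2)

theorem aux_Q_step {I : A → A → Prop} (hsym : ∀ a b, I a b → I b a) {p : List A} {c : A}
    {s s' : List A} (h : SwapStep I s s') (hq : AuxQ I p c s) : AuxQ I p c s' := by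
  obtain ⟨x, y, a, b, hi, h1, h2⟩ := h
  obtain ⟨s1, s2, h3, h4, h5⟩ := hq
  rw [h1] at h3
  subst h2
  have tr : ∀ {q}, SwapStep I (s1 ++ s2) q → TrEq I p q :=
    fun h => EqvGen.trans _ _ _ h5 (EqvGen.rel _ _ h)
  have base : x = s1 → a = c → b :: y = s2 → AuxQ I p c (x ++ b :: a :: y) := by
    rintro rfl rfl rfl
    exact ⟨x ++ [b], y, by simp, fun d hd => h4 d (by simp [hd]), by simpa using h5⟩
  rcases List.append_eq_append_iff.1 h3 with ⟨t, ht1, ht2⟩ | ⟨t, ht1, ht2⟩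
  · rcases t with _ | ⟨d, _ | ⟨e, t⟩⟩
    · simp at ht1 ht2
      exact base ht1.symm ht2.1 ht2.2
    · simp at ht2
      obtain ⟨rfl, rfl, rfl⟩ := ht2
      subst ht1
      refine ⟨x, a :: y, by simp, ?_, by simpa using h5⟩
      intro d hd
      rcases List.mem_cons.1 hd with rfl | hd
      · exact hsym _ _ hi
      · exact h4 d hd
    · simp at ht2
      obtain ⟨rfl, rfl, rfl⟩ := ht2
      subst ht1
      exact ⟨x ++ b :: a :: t, s2, by simp, h4, tr ⟨x, t ++ s2, a, b, hi, by simp, by simp⟩⟩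
  · rcases t with _ | ⟨d, t⟩
    · simp at ht1 ht2
      exact base ht1 ht2.1.symm ht2.2.symm
    · simp at ht2
      obtain ⟨rfl, rfl⟩ := ht2
      subst ht1
      refine ⟨s1, t ++ b :: a :: y, by simp, ?_, tr ⟨s1 ++ t, y, a, b, hi, by simp, by simp⟩⟩
      intro d hd
      apply h4
      simp at hd ⊢
      tauto

theorem aux_key {I : A → A → Prop} (hsym : ∀ a b, I a b → I b a) {p : List A} {c : A}
    {s : List A} (h : TrEq I (p ++ [c]) s) : AuxQ I p c s := by
  have main : ∀ u v, TrEq I u v → (AuxQ I p c u ↔ AuxQ I p c v) := by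
    intro u v h
    unfold TrEq at h
    induction h with
    | rel u v h => exact ⟨aux_Q_step hsym h, aux_Q_step hsym (aux_swap_symm hsym h)⟩
    | refl u => exact Iff.rfl
    | symm u v _ ih => exact ih.symm
    | trans u v w _ _ ih1 ih2 => exact ih1.trans ih2
  exact (main _ _ h).1 ⟨p, [], by simp, by simp, by simpa [TrEq] using EqvGen.refl _⟩

theorem aux_move {I : A → A → Prop} {c : A} (s2 : List A) : ∀ s1 : List A,
    (∀ b ∈ s2, I c b) → TrEq I (s1 ++ c :: s2) (s1 ++ s2 ++ [c]) := by
  induction s2 with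
  | nil => intro s1 _; simpa [TrEq] using EqvGen.refl _
  | cons d s2 ih =>
    intro s1 h
    refine EqvGen.trans _ (s1 ++ d :: c :: s2) _
      (EqvGen.rel _ _ ⟨s1, s2, c, d, h d (by simp), rfl, rfl⟩) ?_
    have := ih (s1 ++ [d]) (fun b hb => h b (by simp [hb]))
    simpa [TrEq] using this

theorem aux_main {I : A → A → Prop} (hsym : ∀ a b, I a b → I b a) {K : Set (List A)}
    (hK : TraceClosed I K) (α : ℕ → A) (n : ℕ) : ∀ v z, v ∈ K → TrEq I (wpre α n) (v ++ z) →
    ∃ m, wpre α m ∈ suffExt I K := by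
  induction n with
  | zero =>
    intro v z hv h
    have key : ∀ u v : List A, TrEq I u v → u.length = v.length := by
      intro u v h
      unfold TrEq at h
      induction h with
      | rel u v h => obtain ⟨x, y, a, b, hi, rfl, rfl⟩ := h; simp
      | refl u => rfl
      | symm u v _ ih => exact ih.symm
      | trans u v w _ _ ih1 ih2 => exact ih1.trans ih2
    have h := key _ _ h
    have hv0 : v = [] := by
      apply List.eq_nil_of_length_eq_zero
      rw [List.length_append] at h
      have h0 : (wpre α 0).length = 0 := rfl
      omega
    subst hv0
    exact ⟨0, Or.inl (by simpa [wpre] using hv)⟩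
  | succ n ih =>
    intro v z hv h
    have hs : wpre α (n + 1) = wpre α n ++ [α n] := by simp [wpre, List.range_succ]
    have h' := h
    rw [hs] at h'
    obtain ⟨s1, s2, h3, h4, h5⟩ := aux_key hsym h'
    have fin : ∀ t, v = s1 ++ α n :: t → s2 = t ++ z → ∃ m, wpre α m ∈ suffExt I K := by
      rintro t rfl rfl
      have hm := aux_move t s1 (fun b hb => h4 b (by simp [hb]))
      refine ⟨n + 1, Or.inr ⟨α n, s1 ++ t, z, hK _ _ hv hm, fun b hb => h4 b (by simp [hb]), ?_⟩⟩
      exact EqvGen.trans _ _ _ h (aux_trEq_append hm z)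
    rcases List.append_eq_append_iff.1 h3 with ⟨t, ht1, ht2⟩ | ⟨t, ht1, ht2⟩
    · subst ht1
      exact ih v (t ++ s2) hv (by simpa using h5)
    · rcases t with _ | ⟨d, t⟩
      · simp at ht1 ht2
        subst ht1
        exact ih v s2 hv h5
      · simp at ht2
        obtain ⟨rfl, h6⟩ := ht2
        exact fin t ht1 h6

/-- `ext(K) ⊆ ext(K_I)` and iterating the `I`-suffix extension does
not change the infinitary extension. -/
theorem stmt2 [Fintype A] (I : A → A → Prop)
    (hirr : ∀ a, ¬ I a a) (hsym : ∀ a b, I a b → I b a)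
    (K : Set (List A)) (hK : TraceClosed I K) :
    extL K ⊆ extL (suffExt I K) ∧
    extL (suffExt I K) = extL (suffExt I (suffExt I K)) := by
  have sub : ∀ L : Set (List A), extL L ⊆ extL (suffExt I L) :=
    fun L α ⟨n, hn⟩ => ⟨n, Or.inl hn⟩
  refine ⟨sub K, Set.Subset.antisymm (sub _) ?_⟩
  rintro α ⟨n, hn | ⟨a, u, x, hu, -, h⟩⟩
  · exact ⟨n, hn⟩
  · rcases hu with hu | ⟨b, u', y, hu', -, h'⟩
    · exact aux_main hsym hK α n _ _ hu h
    · refine aux_main hsym hK α n (u' ++ [b]) (y ++ x) hu' ?_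
      have := EqvGen.trans _ _ _ h (aux_trEq_append h' x)
      simpa [TrEq] using this
end

section
/- If K ⊆ Σ* is a regular trace-closed language, then its I-suffix extension K_I is regular and trace-closed. -/
open Relation

variable {A : Type*} {σ : Type*} {S : Type*}

inductive Spl (I : A → A → Prop) : List A → List A → List A → Prop
  | nil : Spl I [] [] []
  | left {w u y : List A} (c : A) : Spl I w u y → (∀ b ∈ y, I b c) →
      Spl I (w ++ [c]) (u ++ [c]) y
  | right {w u y : List A} (c : A) : Spl I w u y → Spl I (w ++ [c]) u (y ++ [c])

theorem spl_snoc_inv {I : A → A → Prop} {w u y : List A} {c : A}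
    (h : Spl I (w ++ [c]) u y) :
    (∃ u', u = u' ++ [c] ∧ Spl I w u' y ∧ ∀ b ∈ y, I b c) ∨
    (∃ y', y = y' ++ [c] ∧ Spl I w u y') := by
  generalize hz : w ++ [c] = z at h
  cases h with
  | nil => simp at hz
  | left d h1 h2 =>
    obtain ⟨rfl, h⟩ := List.append_inj' hz rfl
    simp at h
    subst h
    exact Or.inl ⟨_, rfl, h1, h2⟩
  | right d h1 =>
    obtain ⟨rfl, h⟩ := List.append_inj' hz rfl
    simp at h
    subst h
    exact Or.inr ⟨_, rfl, h1⟩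

theorem treq_refl (I : A → A → Prop) (u : List A) : TrEq I u u := EqvGen.refl _

theorem TrEq.sm {I : A → A → Prop} {u v : List A} (h : TrEq I u v) : TrEq I v u :=
  EqvGen.symm _ _ h

theorem TrEq.tr {I : A → A → Prop} {u v w : List A} (h : TrEq I u v) (h' : TrEq I v w) :
    TrEq I u w := EqvGen.trans _ _ _ h h'

theorem TrEq.ctx {I : A → A → Prop} {u v : List A} (h : TrEq I u v) (p s : List A) :
    TrEq I (p ++ u ++ s) (p ++ v ++ s) := by
  induction h with
  | rel _ _ h =>
    obtain ⟨x, y, a, b, hab, rfl, rfl⟩ := h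
    exact EqvGen.rel _ _ ⟨p ++ x, y ++ s, a, b, hab, by simp, by simp⟩
  | refl => exact treq_refl _ _
  | symm _ _ _ ih => exact ih.sm
  | trans _ _ _ _ _ h1 h2 => exact h1.tr h2

theorem TrEq.snoc {I : A → A → Prop} {u v : List A} (h : TrEq I u v) (s : List A) :
    TrEq I (u ++ s) (v ++ s) := by simpa using h.ctx [] s

theorem treq_move {I : A → A → Prop} (y : List A) (c : A) (h : ∀ b ∈ y, I b c) :
    TrEq I (y ++ [c]) (c :: y) := by
  induction y with
  | nil => exact treq_refl _ _
  | cons b y ih =>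
    have h1 := (ih (fun d hd => h d (by simp [hd]))).ctx [b] []
    have h2 : TrEq I (b :: c :: y) (c :: b :: y) :=
      EqvGen.rel _ _ ⟨[], y, b, c, h b (by simp), rfl, rfl⟩
    exact TrEq.tr (by simpa using h1) h2

theorem spl_treq {I : A → A → Prop} {w u y : List A} (h : Spl I w u y) :
    TrEq I w (u ++ y) := by
  induction h with
  | nil => exact treq_refl _ _
  | @left w u y c h1 h2 ih =>
    refine (ih.snoc [c]).tr ?_
    simpa using (treq_move y c h2).ctx u []
  | right c h1 ih => simpa using ih.snoc [c]

theorem spl_append (I : A → A → Prop) (u y : List A) : Spl I (u ++ y) u y := by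
  induction y using List.reverseRecOn with
  | nil =>
    induction u using List.reverseRecOn with
    | nil => exact Spl.nil
    | append_singleton u c ih =>
      simpa using Spl.left c (by simpa using ih) (by simp)
  | append_singleton y c ih => simpa using Spl.right c ih

theorem spl_swap {I : A → A → Prop} (hsym : ∀ a b, I a b → I b a) (x : List A) (a b : A)
    (hab : I a b) (z : List A) : ∀ u y, Spl I (x ++ a :: b :: z) u y →
    ∃ u' y', Spl I (x ++ b :: a :: z) u' y' ∧ TrEq I u u' ∧ y.Perm y' := by
  induction z using List.reverseRecOn with
  | nil =>
    intro u y h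
    have e1 : x ++ [a, b] = (x ++ [a]) ++ [b] := by simp
    have e2 : x ++ [b, a] = (x ++ [b]) ++ [a] := by simp
    rw [e1] at h
    rw [e2]
    rcases spl_snoc_inv h with ⟨u1, rfl, h1, hb⟩ | ⟨y1, rfl, h1⟩
    · rcases spl_snoc_inv h1 with ⟨u2, rfl, h2, ha⟩ | ⟨y2, rfl, h2⟩
      · exact ⟨_, _, (h2.left b hb).left a ha,
          EqvGen.rel _ _ ⟨u2, [], a, b, hab, by simp, by simp⟩, List.Perm.refl _⟩
      · exact ⟨_, _, (h2.left b (fun d hd => hb d (by simp [hd]))).right a,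
          treq_refl _ _, List.Perm.refl _⟩
    · rcases spl_snoc_inv h1 with ⟨u2, rfl, h2, ha⟩ | ⟨y2, rfl, h2⟩
      · refine ⟨_, _, (h2.right b).left a ?_, treq_refl _ _, List.Perm.refl _⟩
        intro d hd
        rcases List.mem_append.1 hd with hd | hd
        · exact ha d hd
        · rw [List.mem_singleton.1 hd]; exact hsym _ _ hab
      · refine ⟨_, _, (h2.right b).right a, treq_refl _ _, ?_⟩
        simpa using (List.Perm.swap b a []).append_left y2
  | append_singleton z c ih =>
    intro u y h
    have e1 : ∀ p q : A, x ++ p :: q :: (z ++ [c]) = (x ++ p :: q :: z) ++ [c] := by simp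
    rw [e1] at h
    rw [e1]
    rcases spl_snoc_inv h with ⟨u1, rfl, h1, hc⟩ | ⟨y1, rfl, h1⟩
    · obtain ⟨u', y', h', hu, hy⟩ := ih _ _ h1
      exact ⟨_, _, h'.left c (fun d hd => hc d (hy.mem_iff.2 hd)), hu.snoc [c], hy⟩
    · obtain ⟨u', y', h', hu, hy⟩ := ih _ _ h1
      exact ⟨_, _, h'.right c, hu, hy.append_right _⟩

theorem spl_trans {I : A → A → Prop} (hsym : ∀ a b, I a b → I b a) {w w' : List A}
    (h : TrEq I w w') :
    (∀ u y, Spl I w u y → ∃ u' y', Spl I w' u' y' ∧ TrEq I u u' ∧ y.Perm y') ∧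
    (∀ u y, Spl I w' u y → ∃ u' y', Spl I w u' y' ∧ TrEq I u u' ∧ y.Perm y') := by
  induction h with
  | rel _ _ h =>
    obtain ⟨x, z, a, b, hab, rfl, rfl⟩ := h
    exact ⟨spl_swap hsym x a b hab z, spl_swap hsym x b a (hsym _ _ hab) z⟩
  | refl => exact ⟨fun u y h => ⟨u, y, h, treq_refl _ _, .refl _⟩,
      fun u y h => ⟨u, y, h, treq_refl _ _, .refl _⟩⟩
  | symm _ _ _ ih => exact ⟨ih.2, ih.1⟩
  | trans _ _ _ _ _ h1 h2 =>
    constructor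
    · intro u y h
      obtain ⟨u1, y1, k1, t1, p1⟩ := h1.1 u y h
      obtain ⟨u2, y2, k2, t2, p2⟩ := h2.1 _ _ k1
      exact ⟨u2, y2, k2, t1.tr t2, p1.trans p2⟩
    · intro u y h
      obtain ⟨u1, y1, k1, t1, p1⟩ := h2.2 u y h
      obtain ⟨u2, y2, k2, t2, p2⟩ := h1.2 _ _ k1
      exact ⟨u2, y2, k2, t1.tr t2, p1.trans p2⟩

open Classical in
theorem suff_char {I : A → A → Prop} (hirr : ∀ a, ¬ I a a) (hsym : ∀ a b, I a b → I b a)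
    {K : Set (List A)} (hK : TraceClosed I K) (w : List A) :
    w ∈ suffExt I K ↔ w ∈ K ∨ ∃ a u y, Spl I w u y ∧ u ++ [a] ∈ K ∧ a ∈ y ∧
      ¬ 2 ≤ y.count a ∧ ∀ b ∈ y, b ≠ a → I a b := by
  refine or_congr Iff.rfl ⟨?_, ?_⟩
  · rintro ⟨a, u, x, hu, hx, hw⟩
    have e : u ++ [a] ++ x = u ++ a :: x := by simp
    rw [e] at hw
    obtain ⟨u', y', h', tu, py⟩ := (spl_trans hsym hw.sm).1 _ _ (spl_append I u (a :: x))
    have hax : a ∉ x := fun h => hirr a (hx a h)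
    refine ⟨a, u', y', h', hK _ _ hu (tu.snoc [a]), py.mem_iff.1 (by simp), ?_, ?_⟩
    · rw [← py.count_eq, List.count_cons_self, List.count_eq_zero_of_not_mem hax]
      simp
    · intro b hb hba
      rcases List.mem_cons.1 (py.mem_iff.2 hb) with h | h
      · exact absurd h hba
      · exact hx b h
  · rintro ⟨a, u, y, h, hu, hay, hc, hI⟩
    obtain ⟨y1, y2, rfl⟩ := List.append_of_mem hay
    have hc' : y1.count a + y2.count a = 0 := by
      rw [List.count_append, List.count_cons_self] at hc
      omega
    have n1 : a ∉ y1 := List.count_eq_zero.1 (by omega)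
    have n2 : a ∉ y2 := List.count_eq_zero.1 (by omega)
    have i1 : ∀ b ∈ y1, I a b := fun b hb => hI b (by simp [hb]) (fun e => n1 (e ▸ hb))
    have i2 : ∀ b ∈ y2, I a b := fun b hb => hI b (by simp [hb]) (fun e => n2 (e ▸ hb))
    refine ⟨a, u, y1 ++ y2, hu, ?_, ?_⟩
    · intro b hb
      rcases List.mem_append.1 hb with h | h
      · exact i1 b h
      · exact i2 b h
    · refine (spl_treq h).tr ?_
      simpa using (treq_move y1 a (fun b hb => hsym _ _ (i1 b hb))).ctx u y2

theorem reg_of_fin {β : Type*} [Finite β] (L : Language A) (F : List A → β)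
    (h1 : ∀ w w' c, F w = F w' → F (w ++ [c]) = F (w' ++ [c]))
    (h2 : ∀ w w', F w = F w' → w ∈ L → w' ∈ L) : L.IsRegular := by
  apply Language.IsRegular.of_finite_range_leftQuotient
  have key : ∀ z w w', F w = F w' → F (w ++ z) = F (w' ++ z) := by
    intro z
    induction z with
    | nil => intro w w' h; simpa using h
    | cons c z ih =>
      intro w w' h
      simpa using ih _ _ (h1 w w' c h)
  have hf : ∀ w w', F w = F w' → L.leftQuotient w = L.leftQuotient w' := by
    intro w w' h
    ext z
    exact ⟨h2 _ _ (key z _ _ h), h2 _ _ (key z _ _ h.symm)⟩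
  have hfac : Function.FactorsThrough L.leftQuotient F := fun w w' h => hf w w' h
  obtain ⟨g, hg⟩ := (Function.factorsThrough_iff L.leftQuotient).1 hfac
  rw [hg]
  exact (Set.finite_range g).subset (Set.range_comp_subset_range F g)

open Classical in
def sumY (y : List A) : Set A × Set A := ({b | b ∈ y}, {b | 2 ≤ y.count b})

open Classical in
theorem sumY_snoc {y y' : List A} (c : A) (h : sumY y = sumY y') :
    sumY (y ++ [c]) = sumY (y' ++ [c]) := by
  have h1 : ∀ b, b ∈ y ↔ b ∈ y' := fun b => Set.ext_iff.1 (Prod.ext_iff.1 h).1 b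
  have h2 : ∀ b, 2 ≤ y.count b ↔ 2 ≤ y'.count b :=
    fun b => Set.ext_iff.1 (Prod.ext_iff.1 h).2 b
  refine Prod.ext ?_ ?_
  · ext b
    simp [sumY, h1]
  · ext b
    have k1 := h1 b
    have k2 := h2 b
    rw [← List.count_pos_iff, ← List.count_pos_iff] at k1
    simp only [sumY, Set.mem_ofPred_eq, List.count_append]
    by_cases hb : c = b
    · subst hb
      have k3 : List.count c [c] = 1 := by simp
      rw [k3]
      omega
    · rw [List.count_eq_zero_of_not_mem (a := b) (l := [c]) (by simpa using Ne.symm hb)]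
      simpa using k2

def stF (I : A → A → Prop) (M : DFA A σ) (w : List A) : σ × Set (σ × Set A × Set A) :=
  (M.eval w, {t | ∃ u y, Spl I w u y ∧ t = (M.eval u, sumY y)})

theorem stF_snoc_sub (I : A → A → Prop) (M : DFA A σ) (w w' : List A) (c : A)
    (h : stF I M w = stF I M w') : (stF I M (w ++ [c])).2 ⊆ (stF I M (w' ++ [c])).2 := by
  have hs := (Prod.ext_iff.1 h).2
  rintro t ⟨u, y, hs1, rfl⟩
  rcases spl_snoc_inv hs1 with ⟨u1, rfl, k, hc⟩ | ⟨y1, rfl, k⟩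
  · have : (M.eval u1, sumY y) ∈ (stF I M w').2 := hs ▸ ⟨u1, y, k, rfl⟩
    obtain ⟨u', y', k', e⟩ := this
    obtain ⟨e1, e2⟩ := Prod.ext_iff.1 e
    have hm : ∀ b, b ∈ y ↔ b ∈ y' := fun b => Set.ext_iff.1 (Prod.ext_iff.1 e2).1 b
    refine ⟨u' ++ [c], y', k'.left c (fun b hb => hc b ((hm b).2 hb)), ?_⟩
    simp only at e1 e2
    simp [e1, e2]
  · have : (M.eval u, sumY y1) ∈ (stF I M w').2 := hs ▸ ⟨u, y1, k, rfl⟩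
    obtain ⟨u', y', k', e⟩ := this
    obtain ⟨e1, e2⟩ := Prod.ext_iff.1 e
    refine ⟨u', y' ++ [c], k'.right c, ?_⟩
    exact Prod.ext e1 (sumY_snoc c e2)

/-- If `K` is regular and trace-closed, so is `K_I`. -/
theorem stmt3 [Fintype A] (I : A → A → Prop)
    (hirr : ∀ a, ¬ I a a) (hsym : ∀ a b, I a b → I b a)
    (K : Set (List A)) (hreg : RegularLang K) (hK : TraceClosed I K) :
    RegularLang (suffExt I K) ∧ TraceClosed I (suffExt I K) := by
  constructor
  · obtain ⟨σ, _, M, hM⟩ := hreg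
    have hreg' : Language.IsRegular (suffExt I K : Language A) := by
      refine reg_of_fin _ (stF I M) ?_ ?_
      · intro w w' c h
        refine Prod.ext ?_ (Set.Subset.antisymm (stF_snoc_sub I M _ _ c h)
          (stF_snoc_sub I M _ _ c h.symm))
        have h1 : M.eval w = M.eval w' := (Prod.ext_iff.1 h).1
        simp [stF, h1]
      · intro w w' h hw
        have h1 : M.eval w = M.eval w' := (Prod.ext_iff.1 h).1
        have hs := (Prod.ext_iff.1 h).2
        have hMK : ∀ v v', M.eval v = M.eval v' → v ∈ K → v' ∈ K := by
          intro v v' e hv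
          rw [← hM, DFA.mem_accepts] at hv ⊢
          rwa [← e]
        refine (suff_char hirr hsym hK w').2 ?_
        rcases (suff_char hirr hsym hK w).1 hw with hw | ⟨a, u, y, k, hu, hay, hc, hI⟩
        · exact Or.inl (hMK _ _ h1 hw)
        · have : (M.eval u, sumY y) ∈ (stF I M w').2 := hs ▸ ⟨u, y, k, rfl⟩
          obtain ⟨u', y', k', e⟩ := this
          obtain ⟨e1, e2⟩ := Prod.ext_iff.1 e
          have hm : ∀ b, b ∈ y ↔ b ∈ y' := fun b => Set.ext_iff.1 (Prod.ext_iff.1 e2).1 b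
          have hd := Set.ext_iff.1 (Prod.ext_iff.1 e2).2 a
          simp only at e1
          refine Or.inr ⟨a, u', y', k', hMK _ _ (by simp [e1]) hu, (hm a).1 hay,
            fun h => hc (hd.2 h), fun b hb => hI b ((hm b).2 hb)⟩
    obtain ⟨τ, hτ, N, hN⟩ := hreg'
    exact ⟨τ, hτ, N, fun w => by rw [hN]; rfl⟩
  · rintro u v (hu | ⟨a, p, x, hp, hx, h⟩) huv
    · exact Or.inl (hK _ _ hu huv)
    · exact Or.inr ⟨a, p, x, hp, hx, huv.sm.tr h⟩
end

section
/- Let K ⊆ Σ* be a regular trace-closed language and K_I its I-suffix extension. Then the ω-language ext(K_I) is recognized by an I-diamond deterministic weak automaton. -/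
open Relation

variable {A : Type*} {σ : Type*} {S : Type*}

namespace Stmt6

section
variable {A : Type*} {I : A → A → Prop}

theorem rfl' (u : List A) : TrEq I u u := EqvGen.refl u
theorem symm' {u v : List A} (h : TrEq I u v) : TrEq I v u := EqvGen.symm _ _ h
theorem trans' {u v w : List A} (h : TrEq I u v) (h' : TrEq I v w) : TrEq I u w :=
  EqvGen.trans _ _ _ h h'

theorem ctx {u v : List A} (p s : List A) (h : TrEq I u v) :
    TrEq I (p ++ u ++ s) (p ++ v ++ s) := by
  induction h with
  | rel u v h =>
    obtain ⟨x, y, a, b, hab, rfl, rfl⟩ := h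
    exact EqvGen.rel _ _ ⟨p ++ x, y ++ s, a, b, hab, by simp, by simp⟩
  | refl u => exact rfl' _
  | symm u v _ ih => exact symm' ih
  | trans u v w _ _ ih1 ih2 => exact trans' ih1 ih2

theorem left {u v : List A} (p : List A) (h : TrEq I u v) : TrEq I (p ++ u) (p ++ v) := by
  simpa using ctx p [] h

theorem right {u v : List A} (s : List A) (h : TrEq I u v) : TrEq I (u ++ s) (v ++ s) := by
  simpa using ctx [] s h

theorem both {u v u' v' : List A} (h : TrEq I u v) (h' : TrEq I u' v') :
    TrEq I (u ++ u') (v ++ v') := trans' (right u' h) (left v h')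

theorem perm {u v : List A} (h : TrEq I u v) : u.Perm v := by
  induction h with
  | rel u v h =>
    obtain ⟨x, y, a, b, hab, rfl, rfl⟩ := h
    exact List.Perm.append_left _ (List.Perm.swap _ _ _)
  | refl u => exact List.Perm.refl _
  | symm u v _ ih => exact ih.symm
  | trans u v w _ _ ih1 ih2 => exact ih1.trans ih2

theorem comm1 (a : A) (x : List A) (h : ∀ b ∈ x, I a b) : TrEq I ([a] ++ x) (x ++ [a]) := by
  induction x with
  | nil => exact rfl' _
  | cons b x ih =>
    have h1 : TrEq I ([a] ++ b :: x) (b :: a :: x) :=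
      EqvGen.rel _ _ ⟨[], x, a, b, h b (by simp), by simp, by simp⟩
    have h2 := left [b] (ih (fun c hc => h c (by simp [hc])))
    exact trans' h1 (by simpa using h2)

theorem commBlock (x v : List A) (h : ∀ b ∈ x, ∀ c ∈ v, I b c) :
    TrEq I (x ++ v) (v ++ x) := by
  induction x with
  | nil => simpa using rfl' _
  | cons b x ih =>
    have h1 := left [b] (ih (fun c hc => h c (by simp [hc])))
    have h2 := right x (comm1 b v (h b (by simp)))
    exact trans' (by simpa using h1) (by simpa using h2)

theorem cancel_aux (hsym : ∀ a b, I a b → I b a) (a : A) (x : List A) {y y' : List A}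
    (h : SwapStep I y y')
    (hy : ∃ y1 y2, y = y1 ++ a :: y2 ∧ (∀ b ∈ y2, I a b) ∧ TrEq I x (y1 ++ y2)) :
    ∃ y1 y2, y' = y1 ++ a :: y2 ∧ (∀ b ∈ y2, I a b) ∧ TrEq I x (y1 ++ y2) := by
  obtain ⟨p, s, c, d, hcd, rfl, rfl⟩ := h
  obtain ⟨y1, y2, he, hi, ht⟩ := hy
  rw [List.append_eq_append_iff] at he
  rcases he with ⟨t, h1, h2⟩ | ⟨t, h1, h2⟩
  · -- y1 = p ++ t, c :: d :: s = t ++ a :: y2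
    subst h1
    match t, h2 with
    | [], h2 =>
      simp only [List.nil_append, List.cons.injEq] at h2
      obtain ⟨rfl, rfl⟩ := h2
      refine ⟨p ++ [d], s, by simp, fun b hb => hi b (by simp [hb]), by simpa using ht⟩
    | [e], h2 =>
      simp only [List.cons_append, List.nil_append, List.cons.injEq] at h2
      obtain ⟨rfl, rfl, rfl⟩ := h2
      refine ⟨p, c :: s, by simp, ?_, by simpa using ht⟩
      intro b hb
      rcases List.mem_cons.1 hb with rfl | hb
      · exact hsym _ _ hcd
      · exact hi b hb
    | e :: f :: t, h2 =>
      simp only [List.cons_append, List.cons.injEq] at h2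
      obtain ⟨rfl, rfl, rfl⟩ := h2
      refine ⟨p ++ d :: c :: t, y2, by simp, hi, trans' ht ?_⟩
      exact EqvGen.rel _ _ ⟨p, t ++ y2, c, d, hcd, by simp, by simp⟩
  · subst h1
    match t, h2 with
    | [], h2 =>
      simp only [List.nil_append, List.cons.injEq] at h2
      obtain ⟨rfl, rfl⟩ := h2
      refine ⟨y1 ++ [d], s, by simp, fun b hb => hi b (by simp [hb]), by simpa using ht⟩
    | e :: t, h2 =>
      simp only [List.cons_append, List.cons.injEq] at h2
      obtain ⟨rfl, rfl⟩ := h2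
      refine ⟨y1, t ++ d :: c :: s, by simp, ?_, trans' ht ?_⟩
      · intro b hb
        apply hi
        simp only [List.mem_append, List.mem_cons] at hb ⊢
        tauto
      · exact EqvGen.rel _ _ ⟨y1 ++ t, s, c, d, hcd, by simp, by simp⟩

theorem swap_symm (hsym : ∀ a b, I a b → I b a) {u v : List A} (h : SwapStep I u v) :
    SwapStep I v u := by
  obtain ⟨p, s, c, d, hcd, rfl, rfl⟩ := h
  exact ⟨p, s, d, c, hsym _ _ hcd, rfl, rfl⟩

theorem inv_of_step (hsym : ∀ a b, I a b → I b a) (P : List A → Prop)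
    (hP : ∀ u v, SwapStep I u v → P u → P v) {u v : List A} (h : TrEq I u v) : P u ↔ P v := by
  induction h with
  | rel u v h => exact ⟨hP _ _ h, hP _ _ (swap_symm hsym h)⟩
  | refl u => exact Iff.rfl
  | symm u v _ ih => exact ih.symm
  | trans u v w _ _ ih1 ih2 => exact ih1.trans ih2

theorem cancel (hsym : ∀ a b, I a b → I b a) {a : A} {x y : List A} (h : TrEq I (x ++ [a]) y) :
    ∃ y1 y2, y = y1 ++ a :: y2 ∧ (∀ b ∈ y2, I a b) ∧ TrEq I x (y1 ++ y2) := by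
  refine (inv_of_step hsym (fun y => ∃ y1 y2, y = y1 ++ a :: y2 ∧ (∀ b ∈ y2, I a b) ∧
    TrEq I x (y1 ++ y2)) (fun u v huv hu => cancel_aux hsym a x huv hu) h).1 ?_
  exact ⟨x, [], rfl, by simp, by simpa using rfl' x⟩

/-- Position of a distinguished letter in a concatenation. -/
theorem split {v x y1 y2 : List A} {a : A} (h : v ++ x = y1 ++ a :: y2) :
    (∃ t, v = y1 ++ a :: t ∧ y2 = t ++ x) ∨ (∃ t, x = t ++ a :: y2 ∧ y1 = v ++ t) := by
  rw [List.append_eq_append_iff] at h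
  rcases h with ⟨t, h1, h2⟩ | ⟨t, h1, h2⟩
  · exact Or.inr ⟨t, h2, h1⟩
  · match t, h2 with
    | [], h2 => exact Or.inr ⟨[], by simpa using h2.symm, by simpa using h1.symm⟩
    | e :: t, h2 =>
      simp only [List.cons_append, List.cons.injEq] at h2
      obtain ⟨rfl, rfl⟩ := h2
      exact Or.inl ⟨t, h1, rfl⟩

theorem toEnd {a : A} {y : List A} (x : List A) (h : ∀ b ∈ y, I a b) :
    TrEq I (x ++ a :: y) (x ++ y ++ [a]) := by
  simpa using left x (comm1 a y h)

theorem levi (hsym : ∀ a b, I a b → I b a) (z : List A) : ∀ (w v x : List A),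
    TrEq I (w ++ z) (v ++ x) → ∃ v1 x1 v2 x2, TrEq I w (v1 ++ x1) ∧ TrEq I z (v2 ++ x2) ∧
      TrEq I v (v1 ++ v2) ∧ TrEq I x (x1 ++ x2) ∧ ∀ b ∈ x1, ∀ c ∈ v2, I b c := by
  induction z using List.reverseRecOn with
  | nil =>
    intro w v x h
    exact ⟨v, x, [], [], by simpa using h, rfl' _, by simpa using rfl' _, by simpa using rfl' _,
      by simp⟩
  | append_singleton z a ih =>
    intro w v x h
    rw [← List.append_assoc] at h
    obtain ⟨y1, y2, he, hi, ht⟩ := cancel hsym h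
    rcases split he with ⟨t, rfl, rfl⟩ | ⟨t, rfl, rfl⟩
    · obtain ⟨v1, x1, v2, x2, h1, h2, h3, h4, h5⟩ := ih w (y1 ++ t) x (by simpa using ht)
      have hx : ∀ b ∈ x1 ++ x2, I a b := fun b hb =>
        hi b (List.mem_append_right _ ((perm h4).mem_iff.2 hb))
      refine ⟨v1, x1, v2 ++ [a], x2, h1, ?_, ?_, h4, ?_⟩
      · have := toEnd v2 (a := a) (y := x2) (fun b hb => hx b (by simp [hb]))
        exact trans' (right [a] h2) (by simpa using symm' this)
      · have := toEnd y1 (a := a) (y := t) (fun b hb => hi b (by simp [hb]))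
        exact trans' this (by simpa using right [a] h3)
      · intro b hb c hc
        rcases List.mem_append.1 hc with hc | hc
        · exact h5 b hb c hc
        · simp only [List.mem_singleton] at hc
          subst hc
          exact hsym _ _ (hx b (by simp [hb]))
    · obtain ⟨v1, x1, v2, x2, h1, h2, h3, h4, h5⟩ := ih w v (t ++ y2) (by simpa using ht)
      refine ⟨v1, x1, v2, x2 ++ [a], h1, by simpa using right [a] h2, h3, ?_, h5⟩
      exact trans' (toEnd t hi) (by simpa using right [a] h4)

/-! ### The language `K_I · Σ*` -/

def LL (I : A → A → Prop) (K : Set (List A)) : Language A :=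
  {w | ∃ p s, w = p ++ s ∧ p ∈ suffExt I K}

theorem suff_closed {K : Set (List A)} (hK : TraceClosed I K) : TraceClosed I (suffExt I K) := by
  rintro u v (hu | ⟨a, p, x, h1, h2, h3⟩) h
  · exact Or.inl (hK _ _ hu h)
  · exact Or.inr ⟨a, p, x, h1, h2, trans' (symm' h) h3⟩

theorem suff_key (hsym : ∀ a b, I a b → I b a) {K : Set (List A)} (hK : TraceClosed I K)
    {x : List A} {a b : A} (hab : I a b) (h : x ++ [a] ∈ suffExt I K) :
    x ∈ suffExt I K ∨ x ++ [a] ++ [b] ∈ suffExt I K := by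
  rcases h with h | ⟨c, u, z, h1, h2, h3⟩
  · exact Or.inr (Or.inr ⟨a, x, [b], h, by simpa using hab, rfl' _⟩)
  · obtain ⟨y1, y2, he, hi, ht⟩ := cancel hsym h3
    rcases split he with ⟨t, he', rfl⟩ | ⟨t, rfl, rfl⟩
    · right
      right
      refine ⟨a, y1 ++ t, z ++ [b], hK _ _ h1 ?_, ?_, ?_⟩
      · rw [he']
        exact toEnd y1 (fun d hd => hi d (by simp [hd]))
      · intro d hd
        rcases List.mem_append.1 hd with hd | hd
        · exact hi d (by simp [hd])
        · simp only [List.mem_singleton] at hd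
          exact hd ▸ hab
      · have e1 := right ([a] ++ [b]) ht
        have e2 := ctx (y1 ++ t) [b] (symm' (comm1 a z (fun d hd => hi d (by simp [hd]))))
        exact trans' (by simpa using e1) (by simpa using e2)
    · left
      right
      refine ⟨c, u, t ++ y2, h1, ?_, by simpa using ht⟩
      intro d hd
      apply h2
      simp only [List.mem_append, List.mem_cons] at hd ⊢
      tauto

theorem LL_step (hsym : ∀ a b, I a b → I b a) {K : Set (List A)} (hK : TraceClosed I K)
    (u v : List A) (h : SwapStep I u v) (hu : u ∈ LL I K) : v ∈ LL I K := by
  obtain ⟨x, y, a, b, hab, rfl, rfl⟩ := h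
  obtain ⟨p, s, he, hp⟩ := hu
  rw [List.append_eq_append_iff] at he
  have hsw : ∀ t, TrEq I (x ++ a :: b :: t) (x ++ b :: a :: t) := fun t =>
    EqvGen.rel _ _ ⟨x, t, a, b, hab, rfl, rfl⟩
  rcases he with ⟨t, h1, h2⟩ | ⟨t, h1, h2⟩
  · subst h1
    match t, h2 with
    | [], h2 => exact ⟨x, b :: a :: y, rfl, by simpa using hp⟩
    | [e], h2 =>
      simp only [List.cons_append, List.nil_append, List.cons.injEq] at h2
      obtain ⟨rfl, rfl⟩ := h2
      rcases suff_key hsym hK hab hp with h | h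
      · exact ⟨x, b :: a :: y, rfl, h⟩
      · exact ⟨x ++ b :: a :: [], y, by simp, suff_closed hK _ _ h (by simpa using hsw [])⟩
    | e :: f :: t, h2 =>
      simp only [List.cons_append, List.cons.injEq] at h2
      obtain ⟨rfl, rfl, rfl⟩ := h2
      exact ⟨x ++ b :: a :: t, s, by simp, suff_closed hK _ _ hp (hsw t)⟩
  · subst h1
    exact ⟨p, t ++ b :: a :: y, by simp, hp⟩

theorem LL_app {K : Set (List A)} {w : List A} (s : List A) (h : w ∈ LL I K) :
    w ++ s ∈ LL I K := by
  obtain ⟨p, t, rfl, hp⟩ := h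
  exact ⟨p, t ++ s, by simp, hp⟩

/-! ### Regularity -/

/-- Letters that can be made last. -/
def lasts (I : A → A → Prop) (v : List A) : Set A := {a | ∃ u, TrEq I v (u ++ [a])}

/-- Finite information about `w`. -/
def FF {σ : Type} (I : A → A → Prop) (M : DFA A σ) (w : List A) : Set (σ × Set A × Set A) :=
  {t | ∃ v x, TrEq I w (v ++ x) ∧ t = (M.eval v, {b | b ∈ x}, lasts I v)}

def info {σ : Type} (I : A → A → Prop) (K : Set (List A)) (M : DFA A σ) (w : List A) :
    σ × Set (σ × Set A × Set A) × Prop := (M.eval w, FF I M w, w ∈ LL I K)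

theorem eval_app {σ : Type} (M : DFA A σ) {v v' : List A} (h : M.eval v = M.eval v')
    (z : List A) : M.eval (v ++ z) = M.eval (v' ++ z) := by
  simp only [DFA.eval, DFA.evalFrom_of_append] at h ⊢
  rw [h]

theorem suff_info {σ : Type} (hsym : ∀ a b, I a b → I b a) {K : Set (List A)}
    (hK : TraceClosed I K) (M : DFA A σ) (hM : ∀ w, w ∈ M.accepts ↔ w ∈ K) {w w' : List A}
    (h0 : M.eval w = M.eval w') (h : FF I M w = FF I M w') (z : List A)
    (hz : w ++ z ∈ suffExt I K) : w' ++ z ∈ suffExt I K := by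
  have hMK : ∀ v v' z, M.eval v = M.eval v' → v ++ z ∈ K → v' ++ z ∈ K := by
    intro v v' z hv hk
    rw [← hM, DFA.mem_accepts] at hk ⊢
    rwa [← eval_app M hv]
  rcases hz with hz | ⟨a, u, x, hu, hx, ht⟩
  · exact Or.inl (hMK _ _ _ h0 hz)
  · right
    obtain ⟨v1, x1, v2, x2, h1, h2, h3, h4, h5⟩ := levi hsym z w (u ++ [a]) x ht
    have hmem : (M.eval v1, {b | b ∈ x1}, lasts I v1) ∈ FF I M w' := by
      rw [← h]; exact ⟨v1, x1, h1, rfl⟩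
    obtain ⟨v1', x1', h1', he⟩ := hmem
    simp only [Prod.mk.injEq] at he
    obtain ⟨e1, e2, e3⟩ := he
    have e2' : ∀ b, b ∈ x1 ↔ b ∈ x1' := fun b => Set.ext_iff.1 e2 b
    have hk : v1' ++ v2 ∈ K := hMK _ _ _ e1 (hK _ _ hu h3)
    have hlast : ∃ u', TrEq I (v1' ++ v2) (u' ++ [a]) := by
      obtain ⟨y1, y2, he, hi, -⟩ := cancel hsym h3
      rcases split he with ⟨t, rfl, rfl⟩ | ⟨t, rfl, rfl⟩
      · have : a ∈ lasts I v1' := by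
          rw [← e3]
          exact ⟨y1 ++ t, toEnd y1 (fun b hb => hi b (by simp [hb]))⟩
        obtain ⟨u', hu'⟩ := this
        refine ⟨u' ++ v2, trans' (right v2 hu') ?_⟩
        simpa using toEnd u' (a := a) (y := v2) (fun b hb => hi b (by simp [hb]))
      · exact ⟨v1' ++ t ++ y2, by simpa using toEnd (v1' ++ t) hi⟩
    obtain ⟨u', hu'⟩ := hlast
    refine ⟨a, u', x1' ++ x2, hK _ _ hk hu', ?_, ?_⟩
    · intro b hb
      apply hx
      rw [(perm h4).mem_iff]
      simpa [e2'] using hb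
    · have f1 := both h1' h2
      have f2 := ctx v1' x2 (commBlock x1' v2 (fun b hb => h5 b ((e2' b).2 hb)))
      have f3 := right (x1' ++ x2) hu'
      exact trans' f1 (trans' (by simpa using f2) (by simpa using f3))

theorem LL_info {σ : Type} (hsym : ∀ a b, I a b → I b a) {K : Set (List A)}
    (hK : TraceClosed I K) (M : DFA A σ) (hM : ∀ w, w ∈ M.accepts ↔ w ∈ K) {w w' : List A}
    (h : info I K M w = info I K M w') (z : List A)
    (hz : w ++ z ∈ LL I K) : w' ++ z ∈ LL I K := by
  simp only [info, Prod.mk.injEq] at h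
  obtain ⟨h0, h1, h2⟩ := h
  obtain ⟨p, s, he, hp⟩ := hz
  rw [List.append_eq_append_iff] at he
  rcases he with ⟨t, rfl, rfl⟩ | ⟨t, rfl, rfl⟩
  · exact ⟨w' ++ t, s, by simp, suff_info hsym hK M hM h0 h1 t hp⟩
  · apply LL_app
    rw [← h2]
    exact ⟨p, t, rfl, hp⟩

theorem finite_quot [Fintype A] (hsym : ∀ a b, I a b → I b a) {K : Set (List A)}
    (hK : TraceClosed I K) (hreg : RegularLang K) :
    (Set.range (LL I K).leftQuotient).Finite := by
  obtain ⟨σ, hσ, M, hM⟩ := hreg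
  have hf : (Set.range (info I K M)).Finite := Set.toFinite _
  have hfac : Function.FactorsThrough (LL I K).leftQuotient (info I K M) := by
    intro w w' h
    ext z
    exact ⟨LL_info hsym hK M hM h z, LL_info hsym hK M hM h.symm z⟩
  have : Set.range (LL I K).leftQuotient ⊆
      Set.range (Function.extend (info I K M) (LL I K).leftQuotient (fun _ => 0)) := by
    rintro _ ⟨w, rfl⟩
    exact ⟨info I K M w, hfac.extend_apply _ w⟩
  exact (Set.toFinite _).subset this

theorem wpre_le (α : ℕ → A) {m n : ℕ} (h : m ≤ n) : ∃ s, wpre α n = wpre α m ++ s := by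
  obtain ⟨k, rfl⟩ := Nat.exists_eq_add_of_le h
  exact ⟨_, by simp [wpre, List.range_add]; rfl⟩

theorem wpre_prefix (α : ℕ → A) {n : ℕ} {p s : List A} (h : wpre α n = p ++ s) :
    p = wpre α p.length := by
  have hl : p.length ≤ n := by
    have := congrArg List.length h
    simp [wpre] at this
    omega
  obtain ⟨t, ht⟩ := wpre_le α hl
  rw [h] at ht
  exact (List.append_inj ht (by simp [wpre])).1

end

end Stmt6

/-- For regular trace-closed `K`, `ext(K_I)` is recognized by an
`I`-diamond deterministic weak automaton. -/
theorem stmt6 [Fintype A] (I : A → A → Prop)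
    (hirr : ∀ a, ¬ I a a) (hsym : ∀ a b, I a b → I b a)
    (K : Set (List A)) (hreg : RegularLang K) (hK : TraceClosed I K) :
    ∃ (σ : Type) (_ : Fintype σ) (M : DFA A σ),
      IDiamond I M ∧ IsWeak M ∧ BuchiLang M = extL (suffExt I K) := by
  have hfin := Stmt6.finite_quot hsym hK hreg
  set L := Stmt6.LL I K with hL
  have : Finite (Set.range L.leftQuotient) := hfin
  obtain ⟨n, ⟨e⟩⟩ := Finite.exists_equiv_fin (Set.range L.leftQuotient)
  let q : List A → Fin n := fun w => e ⟨L.leftQuotient w, w, rfl⟩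
  have hq : ∀ w w', q w = q w' ↔ ∀ z, w ++ z ∈ L ↔ w' ++ z ∈ L := by
    intro w w'
    simp only [q, e.apply_eq_iff_eq]
    exact Subtype.ext_iff.trans Set.ext_iff
  have hsur : ∀ s, ∃ w, q w = s := by
    intro s
    obtain ⟨w, hw⟩ := (e.symm s).2
    refine ⟨w, ?_⟩
    rw [← e.apply_symm_apply s]
    simp only [q, hw]
  choose r hr using hsur
  have hcong : ∀ w z, q (r (q w) ++ z) = q (w ++ z) := by
    intro w z
    rw [hq]
    intro y
    have := (hq _ _).1 (hr (q w)) (z ++ y)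
    simpa using this
  let M : DFA A (Fin n) := ⟨fun s a => q (r s ++ [a]), q [], {s | r s ∈ L}⟩
  have hstep : ∀ w a, M.step (q w) a = q (w ++ [a]) := fun w a => hcong w [a]
  have heval : ∀ z w, M.evalFrom (q w) z = q (w ++ z) := by
    intro z
    induction z with
    | nil => intro w; simp
    | cons a z ih => intro w; rw [DFA.evalFrom_cons, hstep, ih]; simp
  have hacc : ∀ w, q w ∈ M.accept ↔ w ∈ L := by
    intro w
    have h : r (q w) ∈ L ↔ w ∈ L := by
      have := (hq _ _).1 (hr (q w)) []
      simpa using this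
    exact h
  refine ⟨Fin n, inferInstance, M, ?_, ?_, ?_⟩
  · intro s a b hab
    have hs : ∀ a b, M.step (M.step s a) b = q (r s ++ [a] ++ [b]) := by
      intro a b
      have h1 : M.step s a = q (r s ++ [a]) := rfl
      rw [h1, hstep]
    rw [hs, hs, hq]
    intro z
    have h1 : ∀ a b, I a b → r s ++ [a] ++ [b] ++ z ∈ L → r s ++ [b] ++ [a] ++ z ∈ L :=
      fun a b hab h => Stmt6.LL_step hsym hK _ _ ⟨r s, z, a, b, hab, by simp, by simp⟩ h
    exact ⟨h1 a b hab, h1 b a (hsym _ _ hab)⟩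
  · have key : ∀ s u, s ∈ M.accept → M.evalFrom s u ∈ M.accept := by
      intro s u h
      rw [← hr s] at h ⊢
      rw [heval, hacc]
      exact Stmt6.LL_app u ((hacc _).1 h)
    rintro s s' ⟨u, rfl⟩ ⟨v, hv⟩
    refine ⟨key s u, fun h => ?_⟩
    rw [← hv]
    exact key _ v h
  · have hst : ∀ w, M.evalFrom M.start w ∈ M.accept ↔ w ∈ L := by
      intro w
      have : M.evalFrom M.start w = q w := by simpa using heval w []
      rw [this, hacc]
    ext α
    simp only [BuchiLang, extL, Set.mem_ofPred_eq, hst]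
    constructor
    · intro h
      obtain ⟨m, -, p, s, he, hp⟩ := h 0
      exact ⟨p.length, by rwa [← Stmt6.wpre_prefix α he]⟩
    · rintro ⟨m, hm⟩ N
      obtain ⟨s, hs⟩ := Stmt6.wpre_le α (le_max_left m N)
      exact ⟨max m N, le_max_right _ _, _, s, hs, hm⟩
end

section
/- Let Σ = {a, b} with independence relation I = {(a,b),(b,a)}, and let L ⊆ Σ^ω be the set of all ω-words α such that either (α contains finitely many occurrences of a, that number is even, and α contains infinitely many occurrences of b), or (α contains infinitely many occurrences of a and finitely many occurrences of b, that number being even), or (α contains infinitely many occurrences of both a and b). Then L is recognized by some deterministic Büchi automaton, but there does not exist any I-diamond deterministic Büchi automaton recognizing L. -/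
open Relation

variable {A : Type*} {σ : Type*} {S : Type*}

/-- The full independence relation on the two-letter alphabet `Bool`
(`a := false`, `b := true`). -/
def I2 : Bool → Bool → Prop := fun x y => x ≠ y

/-- The ω-language of Example: finitely (evenly) many `a`'s and infinitely many
`b`'s, or vice versa, or infinitely many of both. -/
def L7 : Set (ℕ → Bool) :=
  {α | ({n | α n = false}.Finite ∧ Even ({n | α n = false}.ncard) ∧
          {n | α n = true}.Infinite) ∨
       ({n | α n = false}.Infinite ∧ {n | α n = true}.Finite ∧
          Even ({n | α n = true}.ncard)) ∨
       ({n | α n = false}.Infinite ∧ {n | α n = true}.Infinite)}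


theorem wpre_succ7 (α : ℕ → Bool) (n : ℕ) : wpre α (n+1) = wpre α n ++ [α n] := by
  simp [wpre, List.range_succ]

theorem count_succ7 (α : ℕ → Bool) (n : ℕ) (c : Bool) :
    (wpre α (n+1)).count c = (wpre α n).count c + if α n = c then 1 else 0 := by
  rw [wpre_succ7, List.count_append, List.count_singleton]
  simp

theorem count_fin7 (α : ℕ → Bool) (c : Bool) (h : {n | α n = c}.Finite) :
    ∃ N, ∀ n ≥ N, (wpre α n).count c = {n | α n = c}.ncard ∧ α n ≠ c := by
  obtain ⟨B, hB⟩ := h.bddAbove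
  refine ⟨B+1, fun n hn => ⟨?_, fun h => ?_⟩⟩
  · have h1 : ∀ n, (wpre α n).count c = Nat.count (fun m => α m = c) n := by
      intro n
      induction n with
      | zero => simp [wpre]
      | succ k ih => rw [count_succ7, Nat.count_succ, ih]
    rw [h1, Nat.count_eq_card_filter_range, ← Set.ncard_coe_finset]
    congr 1
    ext m
    simp only [Finset.coe_filter, Finset.mem_range, Set.mem_ofPred_eq, and_iff_right_iff_imp]
    intro hm
    have := hB hm
    omega
  · have := hB h
    omega

theorem ev7 {σ : Type} (M : DFA Bool σ) (hM : IDiamond I2 M) (c : Bool) (w : List Bool) :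
    ∀ q, M.evalFrom q w =
      (fun q => M.step q c)^[w.count c] ((fun q => M.step q (!c))^[w.count (!c)] q) := by
  induction w with
  | nil => intro q; simp
  | cons x w ih =>
    intro q
    have hc : Function.Commute (fun q => M.step q (!c)) (fun q => M.step q c) := by
      intro q
      exact hM q c (!c) (by cases c <;> simp [I2])
    rw [DFA.evalFrom_cons, ih]
    by_cases hx : x = c
    · subst hx
      have h1 : (x :: w).count x = w.count x + 1 := by simp
      have h2 : (x :: w).count (!x) = w.count (!x) := by
        rw [List.count_cons]; cases x <;> simp
      rw [h1, h2, Function.iterate_succ_apply]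
      congr 1
      exact (hc.iterate_left _) q
    · have hx : x = !c := by cases x <;> cases c <;> simp_all
      subst hx
      have h1 : ((!c) :: w).count (!c) = w.count (!c) + 1 := by simp
      have h2 : ((!c) :: w).count c = w.count c := by
        rw [List.count_cons]; cases c <;> simp
      rw [h1, h2, Function.iterate_succ_apply]

def gam7 (c : Bool) (i n : ℕ) : Bool := if n < i then c else !c

theorem gam7_count (c : Bool) (i n : ℕ) :
    (wpre (gam7 c i) n).count c = min n i ∧ (wpre (gam7 c i) n).count (!c) = n - i := by
  induction n with
  | zero => simp [wpre]
  | succ n ih =>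
    rw [count_succ7, count_succ7, ih.1, ih.2]
    unfold gam7
    by_cases h : n < i
    · cases c <;> simp [h] <;> omega
    · cases c <;> simp [h] <;> omega

theorem gam7_not (c : Bool) (i : ℕ) (hi : Odd i) : gam7 c i ∉ L7 := by
  have h : {n | gam7 c i n = c} = Set.Iio i := by
    ext n
    simp [gam7]
  have hf : {n | gam7 c i n = c}.Finite := h ▸ Set.finite_Iio i
  have hc : ¬ Even ({n | gam7 c i n = c}.ncard) := by
    rw [h, Nat.not_even_iff_odd, ← Finset.coe_Iio, Set.ncard_coe_finset]
    simpa using hi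
  have hh : ∀ d, c = d → {n | gam7 c i n = d}.Finite ∧ ¬ Even ({n | gam7 c i n = d}.ncard) := by
    rintro d rfl
    exact ⟨hf, hc⟩
  rintro (⟨h1, h2, h3⟩ | ⟨h1, h2, h3⟩ | ⟨h1, h2⟩) <;> rcases hcc : c with _ | _
  · exact (hh _ hcc).2 h2
  · exact h3 (hh _ hcc).1
  · exact h1 (hh _ hcc).1
  · exact (hh _ hcc).2 h3
  · exact h1 (hh _ hcc).1
  · exact h2 (hh _ hcc).1

theorem key7 {σ : Type} [Fintype σ] (M : DFA Bool σ) (hM : IDiamond I2 M)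
    (hL : BuchiLang M = L7) (c : Bool) :
    ∃ N, ∀ w : List Bool, Odd (w.count c) → N ≤ w.count (!c) →
      M.evalFrom M.start w ∉ M.accept := by
  set g : σ → σ := fun q => M.step q (!c) with hg
  obtain ⟨m, n, hmn, he⟩ : ∃ m n : ℕ, m < n ∧ g^[m] = g^[n] := by
    obtain ⟨x, y, hne, he⟩ := Finite.exists_ne_map_eq_of_infinite (fun k : ℕ => g^[k])
    rcases lt_or_gt_of_ne hne with h | h
    · exact ⟨x, y, h, he⟩
    · exact ⟨y, x, h, he.symm⟩
  have hper : ∀ k j, m ≤ j → g^[j + k * (n - m)] = g^[j] := by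
    intro k j hj
    induction k with
    | zero => simp
    | succ k ih =>
      rw [← ih]
      have e1 : j + (k+1) * (n-m) = (j - m + k * (n-m)) + n := by
        rw [Nat.succ_mul]; omega
      have e2 : j + k * (n-m) = (j - m + k * (n-m)) + m := by omega
      rw [e1, e2, Function.iterate_add, Function.iterate_add _ _ m, he]
  refine ⟨m, fun w ho hm hacc => gam7_not c _ ho ?_⟩
  rw [← hL]
  intro N
  refine ⟨w.count c + (w.count (!c) + N * (n - m)), ?_, ?_⟩
  · have : N * 1 ≤ N * (n-m) := Nat.mul_le_mul_left _ (by omega)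
    omega
  · rw [ev7 M hM c] at hacc ⊢
    have := gam7_count c (w.count c) (w.count c + (w.count (!c) + N * (n - m)))
    rw [this.1, this.2, Nat.add_sub_cancel_left, Nat.min_eq_right (by omega)]
    rw [← hg, hper _ _ hm]
    exact hacc

def zig7 (n : ℕ) : Bool :=
  if n = 0 then false else if n = 1 then true else decide (2 ≤ (n - 2) % 4)

theorem zig7_count (n : ℕ) :
    (wpre zig7 (n+2)).count false = 2 * (n/4) + 1 + min (n % 4) 2 ∧
    (wpre zig7 (n+2)).count true = 2 * (n/4) + 1 + (n % 4 - 2) := by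
  induction n with
  | zero => decide
  | succ n ih =>
    rw [show n + 1 + 2 = (n+2)+1 from rfl, count_succ7 _ (n+2), count_succ7 _ (n+2), ih.1, ih.2]
    by_cases h : 2 ≤ n % 4
    · simp [zig7, h]; omega
    · simp [zig7, h]; omega

theorem zig7_mem : zig7 ∈ L7 := by
  right; right
  constructor
  · refine Set.infinite_of_forall_exists_gt fun a => ⟨4 * a + 2, ?_, by omega⟩
    simp [zig7]
  · refine Set.infinite_of_forall_exists_gt fun a => ⟨4 * a + 4, ?_, by omega⟩
    simp [zig7]

/-- State: parity of `a`s, parity of `b`s, last letter, flag. -/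
def aut7 : DFA Bool (Bool × Bool × Bool × Bool) where
  step q x :=
    (q.1 ^^ !x, q.2.1 ^^ x, x,
      (x && !q.1) || (!x && !q.2.1) || (x ^^ q.2.2.1))
  start := (false, false, false, false)
  accept := {q | q.2.2.2 = true}

theorem aut7_par (α : ℕ → Bool) (n : ℕ) :
    (aut7.evalFrom aut7.start (wpre α n)).1 = decide (Odd ((wpre α n).count false)) ∧
    (aut7.evalFrom aut7.start (wpre α n)).2.1 = decide (Odd ((wpre α n).count true)) := by
  induction n with
  | zero => simp [wpre, aut7]
  | succ n ih =>
    rw [count_succ7, count_succ7, wpre_succ7, DFA.evalFrom_append_singleton]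
    generalize aut7.evalFrom aut7.start (wpre α n) = q at ih ⊢
    simp only [aut7, ih.1, ih.2]
    cases α n <;> simp [Nat.odd_add_one, ← Nat.not_odd_iff_even]

theorem aut7_acc (α : ℕ → Bool) (n : ℕ) :
    aut7.evalFrom aut7.start (wpre α (n+2)) ∈ aut7.accept ↔
      (α (n+1) = true ∧ Even ((wpre α (n+1)).count false)) ∨
      (α (n+1) = false ∧ Even ((wpre α (n+1)).count true)) ∨ α (n+1) ≠ α n := by
  have h := aut7_par α (n+1)
  have hl : (aut7.evalFrom aut7.start (wpre α (n+1))).2.2.1 = α n := by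
    rw [wpre_succ7, DFA.evalFrom_append_singleton]; rfl
  rw [wpre_succ7 α (n+1), DFA.evalFrom_append_singleton]
  generalize aut7.evalFrom aut7.start (wpre α (n+1)) = q at h hl ⊢
  simp only [aut7, h.1, h.2, hl, Set.mem_ofPred_eq]
  cases α (n+1) <;> cases α n <;> simp

theorem aut7_lang : BuchiLang aut7 = L7 := by
  ext α
  have hB : α ∈ BuchiLang aut7 ↔ ∀ N, ∃ n ≥ N,
      aut7.evalFrom aut7.start (wpre α (n+2)) ∈ aut7.accept := by
    constructor
    · intro h N
      obtain ⟨n, hn, h⟩ := h (N+2)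
      exact ⟨n-2, by omega, by rwa [show n - 2 + 2 = n by omega]⟩
    · intro h N
      obtain ⟨n, hn, h⟩ := h N
      exact ⟨n+2, by omega, h⟩
  rw [hB]
  simp only [aut7_acc]
  unfold L7
  simp only [Set.mem_ofPred_eq]
  by_cases hf : {n | α n = false}.Finite
  · obtain ⟨N, hN⟩ := count_fin7 α false hf
    have hT : {n | α n = true}.Infinite := by
      refine Set.infinite_of_forall_exists_gt fun a => ⟨a + N + 1, ?_, by omega⟩
      simpa using (hN (a+N+1) (by omega)).2
    have e : ∀ n ≥ N, α n = true := fun n hn => by simpa using (hN n hn).2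
    constructor
    · intro h
      obtain ⟨n, hn, h⟩ := h N
      left
      rw [e n hn, e (n+1) (by omega), (hN (n+1) (by omega)).1] at h
      simp at h
      exact ⟨hf, h, hT⟩
    · rintro (⟨_, h, _⟩ | ⟨h, _⟩ | ⟨h, _⟩)
      · intro K
        refine ⟨K + N, by omega, Or.inl ⟨e _ (by omega), ?_⟩⟩
        rw [(hN _ (by omega)).1]; exact h
      · exact absurd hf h
      · exact absurd hf h
  · by_cases ht : {n | α n = true}.Finite
    · obtain ⟨N, hN⟩ := count_fin7 α true ht
      have e : ∀ n ≥ N, α n = false := fun n hn => by simpa using (hN n hn).2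
      constructor
      · intro h
        obtain ⟨n, hn, h⟩ := h N
        right; left
        rw [e n hn, e (n+1) (by omega), (hN (n+1) (by omega)).1] at h
        simp at h
        exact ⟨hf, ht, h⟩
      · rintro (⟨h, _, _⟩ | ⟨_, _, h⟩ | ⟨_, h⟩)
        · exact absurd h hf
        · intro K
          refine ⟨K + N, by omega, Or.inr (Or.inl ⟨e _ (by omega), ?_⟩)⟩
          rw [(hN _ (by omega)).1]; exact h
        · exact absurd ht h
    · refine ⟨fun _ => Or.inr (Or.inr ⟨hf, ht⟩), fun _ N => ?_⟩
      by_contra hcon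
      push Not at hcon
      have hconst : ∀ k, α (N + k) = α N := by
        intro k
        induction k with
        | zero => rfl
        | succ k ih => rw [← ih]; exact (hcon (N+k) (by omega)).2.2
      obtain ⟨x, hx, hx'⟩ := Set.Infinite.exists_gt hf N
      obtain ⟨y, hy, hy'⟩ := Set.Infinite.exists_gt ht N
      have h1 := hconst (x - N)
      have h2 := hconst (y - N)
      rw [show N + (x - N) = x by omega] at h1
      rw [show N + (y - N) = y by omega] at h2
      simp only [Set.mem_ofPred_eq] at hx hy
      rw [hx] at h1
      rw [hy, ← h1] at h2
      simp at h2

/-- `L7` is DBA recognizable, but not by any `I`-diamond DBA. -/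
theorem stmt7 :
    (∃ (σ : Type) (_ : Fintype σ) (M : DFA Bool σ), BuchiLang M = L7) ∧
    ¬ (∃ (σ : Type) (_ : Fintype σ) (M : DFA Bool σ),
        IDiamond I2 M ∧ BuchiLang M = L7) := by
  refine ⟨⟨_, inferInstance, aut7, aut7_lang⟩, ?_⟩
  rintro ⟨σ, _, M, hM, hL⟩
  obtain ⟨N₁, h₁⟩ := key7 M hM hL false
  obtain ⟨N₂, h₂⟩ := key7 M hM hL true
  have hz : zig7 ∈ BuchiLang M := hL ▸ zig7_mem
  obtain ⟨n, hn, hacc⟩ := hz (2 * (N₁ + N₂) + 10)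
  obtain ⟨k, rfl⟩ : ∃ k, n = k + 2 := ⟨n - 2, by omega⟩
  have hc := zig7_count k
  by_cases ho : Odd ((wpre zig7 (k+2)).count false)
  · refine h₁ _ ho ?_ hacc
    simp only [Bool.not_false]
    omega
  · refine h₂ _ ?_ ?_ hacc
    · rw [Nat.odd_iff] at ho ⊢
      omega
    · simp only [Bool.not_true]
      omega
end

section
/- Let Σ = {a, b, c} with independence relation I = {(b,c),(c,b)}, and let K = {ab}. Then K is trace-closed, but the ω-language ext(K) is not trace-closed: abc^ω ∈ ext(K), acbc^ω ≈_I abc^ω, yet acbc^ω ∉ ext(K). -/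
open Relation

variable {A : Type*} {σ : Type*} {S : Type*}

/-- Independence on `Σ = {a, b, c}` (`a := 0`, `b := 1`, `c := 2`): only `b` and
`c` are independent. -/
def I3 : Fin 3 → Fin 3 → Prop := fun x y => (x = 1 ∧ y = 2) ∨ (x = 2 ∧ y = 1)

/-- `K = {ab}`. -/
def K8 : Set (List (Fin 3)) := {[0, 1]}

/-- The ω-word `a b c^ω`. -/
def α8 : ℕ → Fin 3 := fun n => if n = 0 then 0 else if n = 1 then 1 else 2

/-- The ω-word `a c b c^ω`. -/
def β8 : ℕ → Fin 3 := fun n => if n = 0 then 0 else if n = 2 then 1 else 2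

theorem swap_ne8 {u v : List (Fin 3)} (h : SwapStep I3 u v) : u ≠ [0, 1] ∧ v ≠ [0, 1] := by
  obtain ⟨x, y, a, b, hI, rfl, rfl⟩ := h
  constructor
  all_goals
    intro h
    rcases x with _ | ⟨x1, _ | ⟨x2, x⟩⟩ <;> simp at h
    obtain ⟨h1, h2, h3⟩ := h
    subst h1 h2
    rcases hI with hI | hI <;> simp at hI

theorem trEq_iff8 {u v : List (Fin 3)} (h : TrEq I3 u v) : u = [0, 1] ↔ v = [0, 1] := by
  induction h with
  | rel u v h => simp [(swap_ne8 h).1, (swap_ne8 h).2]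
  | refl => rfl
  | symm _ _ _ ih => exact ih.symm
  | trans _ _ _ _ _ ih1 ih2 => exact ih1.trans ih2

theorem wpre_add3 (γ : ℕ → Fin 3) (n : ℕ) :
    wpre γ (n + 3) = γ 0 :: γ 1 :: γ 2 :: (List.range n).map (fun k => γ (k + 3)) := by
  simp [wpre, List.range_succ_eq_map, Function.comp_def]

theorem wpre_app3 (γ : ℕ → Fin 3) (n : ℕ) :
    wpre γ (n + 3) = wpre γ n ++ [γ n, γ (n + 1), γ (n + 2)] := by
  simp [wpre, List.range_succ]

theorem swap8 (n : ℕ) : SwapStep I3 (wpre α8 (n + 3)) (wpre β8 (n + 3)) := by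
  refine ⟨[0], (List.range n).map (fun _ => 2), 1, 2, Or.inl ⟨rfl, rfl⟩, ?_, ?_⟩ <;>
    rw [wpre_add3] <;> simp [α8, β8]

theorem omEq8 : OmEq I3 β8 α8 := by
  constructor
  · intro n
    refine ⟨n + 3, [β8 n, β8 (n + 1), β8 (n + 2)], ?_⟩
    · rw [← wpre_app3]
      exact EqvGen.symm _ _ (EqvGen.rel _ _ (swap8 n))
  · intro n
    refine ⟨n + 3, [α8 n, α8 (n + 1), α8 (n + 2)], ?_⟩
    · rw [← wpre_app3]
      exact EqvGen.rel _ _ (swap8 n)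

theorem memα8 : α8 ∈ extL K8 := ⟨2, by simp [wpre, K8, α8, List.range_succ]⟩

theorem notMemβ8 : β8 ∉ extL K8 := by
  rintro ⟨n, hn⟩
  have hn : wpre β8 n = [0, 1] := hn
  have hl : n = 2 := by simpa [wpre] using congrArg List.length hn
  subst hl
  simp [wpre, β8, List.range_succ] at hn

theorem omEq_symm8 {α β : ℕ → Fin 3} (h : OmEq I3 α β) : OmEq I3 β α := ⟨h.2, h.1⟩

/-- `K8` is trace-closed, but `ext(K8)` is not trace-closed:
`abc^ω ∈ ext(K8)`, `acbc^ω ≈_I abc^ω`, yet `acbc^ω ∉ ext(K8)`. -/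
theorem stmt8 :
    TraceClosed I3 K8 ∧ α8 ∈ extL K8 ∧ OmEq I3 β8 α8 ∧ β8 ∉ extL K8 ∧
    ¬ OmTraceClosed I3 (extL K8) := by
  refine ⟨?_, memα8, omEq8, notMemβ8, fun h => notMemβ8 (h _ _ memα8 (omEq_symm8 omEq8))⟩
  intro u v hu huv
  exact (trEq_iff8 huv).1 hu
end
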